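/- Refined Vitushkin lower bound in dimension one: let l = m + α with m ∈ ℕ, m ≥ 1, 0 < α ≤ 1 (so l > 1), and let n ≥ 1, d ≥ 2 be integers and P(x,ζ) = Σ_{|k| ≤ d} c_k(x) ζ^k a family on [0,1] polynomial of degree ≤ d in ζ ∈ ℝⁿ with continuous coefficients. Then there exists h ∈ Λ_l([0,1]) ∩ C^m([0,1]) which vanishes identically on [0, 1/20] and such that for every ζ ∈ ℝⁿ there exists a point x(ζ) ∈ [0,1] with: C_∞(l,1)/(n log d)^l ≤ |h(x(ζ))| = ‖h‖_∞ ≤ 2^l · C_∞(l,1)/(n log d)^l, and h(x(ζ)) · P(x(ζ),ζ) ≤ 0, where C_∞(l,1) = 1/( 2^{l+1} · 8^l · (m+1)^{m+1} · (4(1+e))^{m+1} ). -/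

import Mathlib

open Set

noncomputable section

/-- The interval `I = [0,1]`. -/
def I01 : Set ℝ := Icc 0 1

/-- The one-dimensional Hölder class `Λ_l([0,1])`, `l = m + α`, `0 < α ≤ 1`. -/
def HolderClass1 (m : ℕ) (α : ℝ) (f : ℝ → ℝ) : Prop :=
  ContDiffOn ℝ m f I01 ∧
  (∀ j ≤ m, ∀ x ∈ I01, |iteratedDerivWithin j f I01 x| ≤ 1) ∧
  ∀ x ∈ I01, ∀ y ∈ I01,
    |iteratedDerivWithin m f I01 x - iteratedDerivWithin m f I01 y| ≤ |x - y| ^ α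

/-- Multi-indices `k ∈ ℕ^n` with `|k| = Σ kᵢ ≤ d`. -/
def degSet (n d : ℕ) : Finset (Fin n → ℕ) :=
  (Fintype.piFinset fun _ => Finset.range (d + 1)).filter fun k => ∑ i, k i ≤ d

/-- `C_∞(l,1) = 1/(2^{l+1} · 8^l · (m+1)^{m+1} · (4(1+e))^{m+1})`, `l = m + α`. -/
def Cinf1 (m : ℕ) (α : ℝ) : ℝ :=
  1 / ((2:ℝ) ^ ((m:ℝ) + α + 1) * (8:ℝ) ^ ((m:ℝ) + α)
      * ((m:ℝ) + 1) ^ (m + 1) * (4 * (1 + Real.exp 1)) ^ (m + 1))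

/-- Monomial exponents of total degree at most `t`. -/
abbrev Simplex (n t : ℕ) : Set (Fin n →₀ ℕ) := {s | (s.sum fun _ e => e) ≤ t}

lemma simplex_finite (n t : ℕ) : Finite (Simplex n t) := by
  have h : Set.Finite {f : Fin n →₀ ℕ | ∀ a, f a ≤ t} :=
    (Set.Finite.pi' fun _ ↦ Set.finite_le_nat _).preimage DFunLike.coe_injective.injOn
  rw [Set.finite_coe_iff]
  refine h.subset fun s hs i ↦ ?_
  rcases eq_or_ne (s i) 0 with h0 | h0
  · omega
  · exact (Finset.single_le_sum (f := fun i => s i) (fun _ _ ↦ Nat.zero_le _)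
      (Finsupp.mem_support_iff.mpr h0)).trans hs

lemma simplex_card_le (n t q : ℕ) (hq : 0 < q) :
    Nat.card (Simplex n (q * t)) ≤ q ^ n * Nat.card (Simplex n t) := by
  have := simplex_finite n t
  have h1 : q ^ n * Nat.card (Simplex n t) = Nat.card ((Fin n → Fin q) × Simplex n t) := by
    simp [Nat.card_prod]
  rw [h1]
  let f : Simplex n (q * t) → (Fin n → Fin q) × Simplex n t := fun s =>
    (fun i => ⟨s.1 i % q, Nat.mod_lt _ hq⟩,
      ⟨Finsupp.equivFunOnFinite.symm (fun i => s.1 i / q), by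
        have hs := s.2
        simp only [Simplex, Set.mem_ofPred_eq] at hs ⊢
        rw [Finsupp.sum_fintype _ _ (fun _ => rfl)] at hs ⊢
        simp only [Finsupp.equivFunOnFinite_symm_apply_apply]
        refine Nat.le_of_mul_le_mul_left (c := q) ?_ hq
        rw [Finset.mul_sum]
        exact (Finset.sum_le_sum fun i _ => Nat.mul_div_le _ _).trans hs⟩)
  refine Nat.card_le_card_of_injective f ?_
  intro s s' h
  apply Subtype.ext
  ext i
  have ha : s.1 i % q = s'.1 i % q := by
    have := congrFun (congrArg Prod.fst h) i
    simpa [f] using this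
  have hb : s.1 i / q = s'.1 i / q := by
    have := congrArg (fun z => (z.2 : Fin n →₀ ℕ) i) h
    simpa [f] using this
  rw [← Nat.div_add_mod (s.1 i) q, ← Nat.div_add_mod (s'.1 i) q, ha, hb]

lemma finrank_rtd (n t : ℕ) :
    Module.finrank ℝ (MvPolynomial.restrictTotalDegree (Fin n) ℝ t) = Nat.card (Simplex n t) := by
  have := simplex_finite n t
  exact Module.finrank_eq_nat_card_basis (MvPolynomial.basisRestrictSupport ℝ (Simplex n t))

lemma totalDegree_aeval_le {n k D : ℕ} (F : Fin k → MvPolynomial (Fin n) ℝ)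
    (hF : ∀ j, (F j).totalDegree ≤ D) (p : MvPolynomial (Fin k) ℝ) :
    (MvPolynomial.aeval F p).totalDegree ≤ D * p.totalDegree := by
  rw [MvPolynomial.aeval_def, MvPolynomial.eval₂_eq]
  refine MvPolynomial.totalDegree_finsetSum_le fun s hs => ?_
  refine (MvPolynomial.totalDegree_mul _ _).trans ?_
  have h1 : (algebraMap ℝ (MvPolynomial (Fin n) ℝ) (MvPolynomial.coeff s p)).totalDegree = 0 := by
    rw [MvPolynomial.algebraMap_eq]; exact MvPolynomial.totalDegree_C _
  rw [h1, zero_add]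
  refine (MvPolynomial.totalDegree_finsetProd _ _).trans ?_
  have h2 : (s.sum fun _ e => e) ≤ p.totalDegree := MvPolynomial.le_totalDegree hs
  refine le_trans ?_ (Nat.mul_le_mul_left D h2)
  rw [Finsupp.sum, Finset.mul_sum]
  refine Finset.sum_le_sum fun i _ => ?_
  refine (MvPolynomial.totalDegree_pow _ _).trans ?_
  rw [mul_comm]
  exact Nat.mul_le_mul_right _ (hF i)

lemma exists_relation {n D : ℕ} (F : Fin n → MvPolynomial (Fin n) ℝ)
    (hF : ∀ j, (F j).totalDegree ≤ D) (u : MvPolynomial (Fin n) ℝ) (hu : u.totalDegree ≤ 1) :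
    ∃ p : Fin ((D + 1) ^ n + 1) → MvPolynomial (Fin n) ℝ, p ≠ 0 ∧
      ∑ i, MvPolynomial.aeval F (p i) * u ^ (i : ℕ) = 0 := by
  set M := (D + 1) ^ n + 1 with hM
  let V := MvPolynomial.restrictTotalDegree (Fin n) ℝ M
  let W := MvPolynomial.restrictTotalDegree (Fin n) ℝ ((D + 1) * M)
  let Φ : (Fin M → V) →ₗ[ℝ] MvPolynomial (Fin n) ℝ :=
    ∑ i : Fin M, (LinearMap.mulRight ℝ (u ^ (i : ℕ))) ∘ₗ (MvPolynomial.aeval F).toLinearMap ∘ₗ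
      V.subtype ∘ₗ LinearMap.proj i
  have hΦ : ∀ p, Φ p = ∑ i, MvPolynomial.aeval F (p i : MvPolynomial (Fin n) ℝ) * u ^ (i : ℕ) := by
    intro p
    simp [Φ, LinearMap.sum_apply]
  have hmem : ∀ p, Φ p ∈ W := by
    intro p
    rw [MvPolynomial.mem_restrictTotalDegree, hΦ]
    refine MvPolynomial.totalDegree_finsetSum_le fun i _ => ?_
    refine (MvPolynomial.totalDegree_mul _ _).trans ?_
    have h1 := totalDegree_aeval_le F hF (p i : MvPolynomial (Fin n) ℝ)
    have h2 : (p i : MvPolynomial (Fin n) ℝ).totalDegree ≤ M :=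
      (MvPolynomial.mem_restrictTotalDegree _ _ _).1 (p i).2
    have h3 : (u ^ (i : ℕ)).totalDegree ≤ M := by
      refine (MvPolynomial.totalDegree_pow _ _).trans ?_
      have := i.2
      nlinarith
    have h4 := Nat.mul_le_mul_left D h2
    linarith
  let Ψ : (Fin M → V) →ₗ[ℝ] W := Φ.codRestrict W hmem
  have hker : LinearMap.ker Ψ ≠ ⊥ := by
    refine LinearMap.ker_ne_bot_of_finrank_lt ?_
    rw [Module.finrank_pi_fintype]
    simp only [V, W, finrank_rtd]
    have h1 := simplex_card_le n M (D + 1) (by omega)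
    have := simplex_finite n M
    have h2 : 0 < Nat.card (Simplex n M) := by
      have : Nonempty (Simplex n M) := ⟨⟨0, by simp [Simplex]⟩⟩
      exact Nat.card_pos
    simp only [Finset.sum_const, Finset.card_univ, Fintype.card_fin, smul_eq_mul]
    refine lt_of_le_of_lt h1 ?_
    exact Nat.mul_lt_mul_of_pos_right (by omega) h2
  obtain ⟨p, hp, hp0⟩ := (Submodule.ne_bot_iff _).1 hker
  refine ⟨fun i => (p i : MvPolynomial (Fin n) ℝ), ?_, ?_⟩
  · intro h
    apply hp0
    ext1 i
    exact Subtype.ext (congrFun h i)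
  · rw [← hΦ]
    have : Ψ p = 0 := hp
    exact congrArg Subtype.val this

/-- Points are separated by some form on the moment curve. -/
lemma exists_separating {n : ℕ} (T : Finset (Fin n → ℝ)) :
    ∃ t < T.card ^ 2 * n + 1, ∀ x ∈ T, ∀ y ∈ T, 
      ∑ i : Fin n, (t : ℝ) ^ (i : ℕ) * x i = ∑ i : Fin n, (t : ℝ) ^ (i : ℕ) * y i → x = y := by
  classical
  let Q : (Fin n → ℝ) → Polynomial ℝ := fun x => ∑ i : Fin n, Polynomial.C (x i) * Polynomial.X ^ (i : ℕ)
  have hcoeff : ∀ x (i : Fin n), (Q x).coeff i = x i := by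
    intro x i
    simp only [Q, Polynomial.finsetSum_coeff, Polynomial.coeff_C_mul_X_pow]
    rw [Finset.sum_eq_single i]
    · simp
    · intro b _ hb
      rw [if_neg]
      intro h
      exact hb (Fin.ext h.symm)
    · simp
  have hQ0 : ∀ x, Q x = 0 → x = 0 := by
    intro x h
    ext i
    rw [← hcoeff x i, h]; simp
  have hdeg : ∀ x, (Q x).natDegree ≤ n := by
    intro x
    refine Polynomial.natDegree_sum_le_of_forall_le _ _ fun i _ => ?_
    exact (Polynomial.natDegree_C_mul_X_pow_le _ _).trans i.2.le
  have heval : ∀ x (t : ℝ), (Q x).eval t = ∑ i : Fin n, t ^ (i : ℕ) * x i := by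
    intro x t
    simp only [Q, Polynomial.eval_finsetSum, Polynomial.eval_mul, Polynomial.eval_C,
      Polynomial.eval_pow, Polynomial.eval_X]
    exact Finset.sum_congr rfl fun i _ => mul_comm _ _
  let bad : Finset ℝ := (T ×ˢ T).biUnion fun z => (Q (z.1 - z.2)).roots.toFinset
  have hbad : bad.card ≤ T.card ^ 2 * n := by
    refine (Finset.card_biUnion_le_card_mul _ _ n fun z _ => ?_).trans ?_
    · exact (Multiset.toFinset_card_le _).trans ((Polynomial.card_roots' _).trans (hdeg _))
    · rw [Finset.card_product, sq]
  let S : Finset ℝ := (Finset.range (T.card ^ 2 * n + 1)).image (fun t : ℕ => (t : ℝ))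
  have hS : S.card = T.card ^ 2 * n + 1 := by
    rw [Finset.card_image_of_injective _ Nat.cast_injective, Finset.card_range]
  obtain ⟨s, hs, hsb⟩ := Finset.exists_mem_notMem_of_card_lt_card (s := bad) (t := S) (by omega)
  obtain ⟨t, ht, rfl⟩ := Finset.mem_image.1 hs
  refine ⟨t, Finset.mem_range.1 ht, fun x hx y hy hxy => ?_⟩
  by_contra hne
  apply hsb
  refine Finset.mem_biUnion.2 ⟨(x, y), Finset.mem_product.2 ⟨hx, hy⟩, ?_⟩
  rw [Multiset.mem_toFinset, Polynomial.mem_roots]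
  · rw [Polynomial.IsRoot, heval]
    simp only [Pi.sub_apply, mul_sub, Finset.sum_sub_distrib]
    linarith
  · intro h
    exact hne (sub_eq_zero.1 (hQ0 _ h))

/-- Elementary Bezout bound: fibres of a polynomial map over generic points. -/
lemma fibre_bound {n D : ℕ} (F : Fin n → MvPolynomial (Fin n) ℝ)
    (hF : ∀ j, (F j).totalDegree ≤ D) :
    ∃ p : MvPolynomial (Fin n) ℝ, p ≠ 0 ∧ ∀ v : Fin n → ℝ, MvPolynomial.eval v p ≠ 0 →
      ∀ T : Finset (Fin n → ℝ), (∀ x ∈ T, ∀ j, MvPolynomial.eval x (F j) = v j) →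
        T.card ≤ (D + 1) ^ n := by
  classical
  let u : ℕ → MvPolynomial (Fin n) ℝ := fun t =>
    ∑ i : Fin n, MvPolynomial.C ((t : ℝ) ^ (i : ℕ)) * MvPolynomial.X i
  have hu : ∀ t, (u t).totalDegree ≤ 1 := by
    intro t
    refine MvPolynomial.totalDegree_finsetSum_le fun i _ => ?_
    refine (MvPolynomial.totalDegree_mul _ _).trans ?_
    rw [MvPolynomial.totalDegree_C, MvPolynomial.totalDegree_X]
  obtain ⟨M, hM⟩ : ∃ M, M = (D + 1) ^ n + 1 := ⟨_, rfl⟩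
  have hrel : ∀ t, ∃ p : Fin M → MvPolynomial (Fin n) ℝ, p ≠ 0 ∧
      ∑ i, MvPolynomial.aeval F (p i) * (u t) ^ (i : ℕ) = 0 := by
    intro t
    rw [hM]
    exact exists_relation F hF (u t) (hu t)
  choose p hp0 hp using hrel
  have hex : ∀ t, ∃ i, p t i ≠ 0 := fun t => Function.ne_iff.1 (hp0 t)
  choose k hk using hex
  refine ⟨∏ t ∈ Finset.range (M ^ 2 * n + 1), p t (k t), Finset.prod_ne_zero_iff.2 fun t _ => hk t, ?_⟩
  intro v hv T hT
  by_contra hcard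
  obtain ⟨T', hT'T, hT'⟩ := Finset.exists_subset_card_eq (s := T) (n := M) (by omega)
  obtain ⟨t, ht, hsep⟩ := exists_separating T'
  rw [hT'] at ht
  rw [map_prod, Finset.prod_ne_zero_iff] at hv
  have hvt := hv t (Finset.mem_range.2 ht)
  let R : Polynomial ℝ := ∑ i : Fin M, Polynomial.C (MvPolynomial.eval v (p t i)) * Polynomial.X ^ (i : ℕ)
  have hcoeff : R.coeff (k t) = MvPolynomial.eval v (p t (k t)) := by
    simp only [R, Polynomial.finsetSum_coeff, Polynomial.coeff_C_mul_X_pow]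
    rw [Finset.sum_eq_single (k t)]
    · simp
    · intro b _ hb
      rw [if_neg]
      intro h
      exact hb (Fin.ext h.symm)
    · simp
  have hR0 : R ≠ 0 := by
    intro h
    rw [h] at hcoeff
    exact hvt hcoeff.symm
  have hRdeg : R.natDegree ≤ M - 1 := by
    refine Polynomial.natDegree_sum_le_of_forall_le _ _ fun i _ => ?_
    exact (Polynomial.natDegree_C_mul_X_pow_le _ _).trans (by have := i.2; omega)
  let e : (Fin n → ℝ) → ℝ := fun x => ∑ i : Fin n, (t : ℝ) ^ (i : ℕ) * x i
  have hroot : T'.image e ⊆ R.roots.toFinset := by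
    intro z hz
    obtain ⟨x, hx, rfl⟩ := Finset.mem_image.1 hz
    rw [Multiset.mem_toFinset, Polynomial.mem_roots hR0, Polynomial.IsRoot]
    have h1 := congrArg (MvPolynomial.eval x) (hp t)
    have hFv : ∀ q : MvPolynomial (Fin n) ℝ,
        MvPolynomial.eval x (MvPolynomial.aeval F q) = MvPolynomial.eval v q := by
      intro q
      have : (fun j => MvPolynomial.eval x (F j)) = v := funext fun j => hT x (hT'T hx) j
      rw [← this]
      have h2 := MvPolynomial.map_aeval F (MvPolynomial.eval x) q
      rw [h2]
      have : (MvPolynomial.eval x).comp (algebraMap ℝ (MvPolynomial (Fin n) ℝ)) = RingHom.id ℝ := by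
        ext; simp [MvPolynomial.algebraMap_eq]
      rw [this]
      rfl
    have hue : MvPolynomial.eval x (u t) = e x := by simp [u, e]
    simp only [map_sum, map_mul, map_pow, map_zero, hFv, hue] at h1
    simpa [R, Polynomial.eval_finsetSum] using h1
  have hinj : (T'.image e).card = M := by
    rw [Finset.card_image_of_injOn, hT']
    intro x hx y hy hxy
    exact hsep x hx y hy hxy
  have h3 := (Finset.card_le_card hroot).trans
    ((Multiset.toFinset_card_le _).trans ((Polynomial.card_roots' R).trans hRdeg))
  omega

lemma exists_alg_relation {n : ℕ} (F : Fin (n + 1) → MvPolynomial (Fin n) ℝ) :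
    ∃ p : MvPolynomial (Fin (n + 1)) ℝ, p ≠ 0 ∧ MvPolynomial.aeval F p = 0 := by
  by_contra h
  push Not at h
  have hai : AlgebraicIndependent ℝ F := by
    rw [algebraicIndependent_iff]
    intro p hp
    by_contra h0
    exact h p h0 hp
  have := hai.cardinalMk_le_trdeg
  rw [MvPolynomial.trdeg_of_isDomain] at this
  simp at this

lemma hasDerivAt_eval_update {n : ℕ} (p : MvPolynomial (Fin n) ℝ) (x : Fin n → ℝ) (j : Fin n) (z : ℝ) :
    HasDerivAt (fun z => MvPolynomial.eval (Function.update x j z) p)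
      (MvPolynomial.eval (Function.update x j z) (MvPolynomial.pderiv j p)) z := by
  induction p using MvPolynomial.induction_on with
  | C a => simpa using hasDerivAt_const z a
  | add p q hp hq =>
    simp only [map_add]
    exact hp.add hq
  | mul_X p i hp =>
    have hX : HasDerivAt (fun z => (Function.update x j z) i) (if i = j then 1 else 0) z := by
      by_cases h : i = j
      · subst h
        simp only [Function.update_self, if_true]
        exact hasDerivAt_id z
      · simpa [Function.update_of_ne h, h] using hasDerivAt_const z (x i)
    have h1 := hp.mul hX
    have h2 : MvPolynomial.eval (Function.update x j z) (MvPolynomial.pderiv j (p * MvPolynomial.X i))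
        = MvPolynomial.eval (Function.update x j z) (MvPolynomial.pderiv j p) * Function.update x j z i
          + MvPolynomial.eval (Function.update x j z) p * (if i = j then 1 else 0) := by
      rw [MvPolynomial.pderiv_mul, MvPolynomial.pderiv_X]
      by_cases h : i = j
      · subst h; simp
      · simp [h]
    rw [h2]
    simp only [map_mul, MvPolynomial.eval_X]
    exact h1

lemma hasDerivAt_posPow (k : ℕ) (x : ℝ) :
    HasDerivAt (fun y : ℝ => (max 0 y) ^ (k + 2)) ((k + 2 : ℝ) * (max 0 x) ^ (k + 1)) x := by
  rcases lt_trichotomy x 0 with h | h | h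
  · rw [max_eq_left h.le]
    simp only [ne_eq, Nat.add_eq_zero_iff, one_ne_zero, and_false, not_false_eq_true, zero_pow, mul_zero]
    refine (hasDerivAt_const x (0:ℝ)).congr_of_eventuallyEq ?_
    filter_upwards [gt_mem_nhds h] with y hy
    rw [max_eq_left (le_of_lt hy)]; simp
  · subst h
    have h1 : HasDerivWithinAt (fun y : ℝ => (max 0 y) ^ (k + 2)) 0 (Iic 0) 0 := by
      refine (hasDerivWithinAt_const (0:ℝ) (Iic 0) (0:ℝ)).congr ?_ (by simp)
      intro y hy
      rw [max_eq_left (show y ≤ 0 from hy)]; simp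
    have h2 : HasDerivWithinAt (fun y : ℝ => (max 0 y) ^ (k + 2)) 0 (Ici 0) 0 := by
      have h3 : HasDerivWithinAt (fun y : ℝ => y ^ (k + 2)) 0 (Ici 0) 0 := by
        simpa using (hasDerivAt_pow (k + 2) (0:ℝ)).hasDerivWithinAt (s := Ici 0)
      refine h3.congr ?_ (by simp)
      intro y hy
      rw [max_eq_right (show 0 ≤ y from hy)]
    have h4 := h1.union h2
    rw [Iic_union_Ici, hasDerivWithinAt_univ] at h4
    simpa using h4
  · rw [max_eq_right h.le]
    have h3 : HasDerivAt (fun y : ℝ => y ^ (k + 2)) ((k + 2 : ℝ) * x ^ (k + 1)) x := by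
      simpa using (hasDerivAt_pow (k + 2) x)
    refine h3.congr_of_eventuallyEq ?_
    filter_upwards [lt_mem_nhds h] with y hy
    rw [max_eq_right (le_of_lt hy)]

lemma exists_penalty_min {n N : ℕ} (P : Fin N → MvPolynomial (Fin n) ℝ) (s ε : Fin N → ℝ)
    (K : ℝ) (hK : 0 < K) (v : Fin n → ℝ) :
    ∃ x : Fin n → ℝ,
      (∀ y : Fin n → ℝ, (∀ i, ε i ≤ s i * MvPolynomial.eval y (P i)) →
        ∀ i, K * (max 0 (ε i - s i * MvPolynomial.eval x (P i))) ^ 2 ≤ ∑ j, (y j - v j) ^ 2) ∧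
      ∀ j, x j - ∑ i, K * (max 0 (ε i - s i * MvPolynomial.eval x (P i))) * s i *
        MvPolynomial.eval x (MvPolynomial.pderiv j (P i)) = v j := by
  let Φ : (Fin n → ℝ) → ℝ := fun x => ∑ j, (x j - v j) ^ 2 +
    ∑ i, K * (max 0 (ε i - s i * MvPolynomial.eval x (P i))) ^ 2
  have hcont : Continuous Φ := by
    have : ∀ i, Continuous fun x => MvPolynomial.eval x (P i) := fun i => MvPolynomial.continuous_eval _
    fun_prop
  have hnn : ∀ x i, 0 ≤ K * (max 0 (ε i - s i * MvPolynomial.eval x (P i))) ^ 2 := by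
    intro x i; positivity
  have hcoer : ∀ᶠ x in Filter.cocompact (Fin n → ℝ), Φ v ≤ Φ x := by
    have hn := tendsto_norm_cocompact_atTop (E := Fin n → ℝ)
    filter_upwards [hn.eventually_ge_atTop (‖v‖ + (Φ v + 1))] with x hx
    have hv0 : 0 ≤ Φ v := add_nonneg (Finset.sum_nonneg fun j _ => sq_nonneg _)
      (Finset.sum_nonneg fun i _ => hnn v i)
    have h1 : Φ v + 1 ≤ ‖x - v‖ := by
      have := norm_sub_norm_le x v
      linarith
    have h2 : ∃ j, Φ v + 1 ≤ |x j - v j| := by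
      by_contra hcon
      push Not at hcon
      have := (pi_norm_lt_iff (x := x - v) (r := Φ v + 1) (by linarith)).2 (fun j => by
        simpa using hcon j)
      linarith
    obtain ⟨j, hj⟩ := h2
    have h3 : (x j - v j) ^ 2 ≤ ∑ j, (x j - v j) ^ 2 :=
      Finset.single_le_sum (f := fun j => (x j - v j) ^ 2) (fun j _ => sq_nonneg _) (Finset.mem_univ j)
    have h4 : 0 ≤ ∑ i, K * (max 0 (ε i - s i * MvPolynomial.eval x (P i))) ^ 2 :=
      Finset.sum_nonneg fun i _ => hnn x i
    have h5 : Φ v ≤ (x j - v j) ^ 2 := by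
      rw [← sq_abs]
      nlinarith
    show Φ v ≤ _ + _
    linarith
  obtain ⟨x, hx⟩ := hcont.exists_forall_le' v hcoer
  refine ⟨x, ?_, ?_⟩
  · intro y hy i
    have h1 : Φ y = ∑ j, (y j - v j) ^ 2 := by
      simp only [Φ]
      rw [Finset.sum_eq_zero (s := (Finset.univ : Finset (Fin N))), add_zero]
      intro i _
      rw [max_eq_left (by linarith [hy i])]; simp
    rw [← h1]
    refine le_trans ?_ (hx y)
    have h3 := Finset.single_le_sum (f := fun i => K * (max 0 (ε i - s i * MvPolynomial.eval x (P i))) ^ 2)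
      (fun i _ => hnn x i) (Finset.mem_univ i)
    have h4 : 0 ≤ ∑ j, (x j - v j) ^ 2 := Finset.sum_nonneg fun j _ => sq_nonneg _
    show _ ≤ _ + _
    linarith
  · intro j
    have hmin : IsLocalMin (fun z => Φ (Function.update x j z)) (x j) := by
      refine Filter.Eventually.of_forall fun z => ?_
      show Φ (Function.update x j (x j)) ≤ _
      rw [Function.update_eq_self]
      exact hx _
    have hd1 : HasDerivAt (fun z => ∑ k, (Function.update x j z k - v k) ^ 2) (2 * (x j - v j)) (x j) := by
      have : ∀ k ∈ (Finset.univ : Finset (Fin n)), HasDerivAt (fun z => (Function.update x j z k - v k) ^ 2)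
          (if k = j then 2 * (x j - v j) else 0) (x j) := by
        intro k _
        by_cases h : k = j
        · subst h
          have h1 := ((hasDerivAt_id (x k)).sub_const (v k)).pow 2
          simp only [Function.update_self, if_true]
          simp only [id, Nat.cast_ofNat, Nat.add_one_sub_one, pow_one, mul_one] at h1
          exact h1
        · simpa [Function.update_of_ne h, h] using hasDerivAt_const (x j) ((x k - v k) ^ 2)
      simpa using HasDerivAt.fun_sum this
    have hd2 : HasDerivAt (fun z => ∑ i, K * (max 0 (ε i - s i * 
        MvPolynomial.eval (Function.update x j z) (P i))) ^ 2)
        (∑ i, K * ((2 * (max 0 (ε i - s i * MvPolynomial.eval x (P i)))) *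
          (- (s i * MvPolynomial.eval x (MvPolynomial.pderiv j (P i)))))) (x j) := by
      refine HasDerivAt.fun_sum fun i _ => ?_
      refine HasDerivAt.const_mul K ?_
      have h1 := hasDerivAt_eval_update (P i) x j (x j)
      rw [Function.update_eq_self] at h1
      have h2 := (h1.const_mul (s i)).const_sub (ε i)
      have h3 := hasDerivAt_posPow 0 (ε i - s i * MvPolynomial.eval x (P i))
      have h4 : HasDerivAt (fun y : ℝ => (max 0 y) ^ 2)
        (2 * (max 0 (ε i - s i * MvPolynomial.eval x (P i))))
          (ε i - s i * MvPolynomial.eval (Function.update x j (x j)) (P i)) := by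
        rw [Function.update_eq_self]
        simpa using h3
      exact h4.comp (x j) h2
    have h0 := hmin.hasDerivAt_eq_zero (hd1.add hd2)
    have h5 : ∑ i, K * ((2 * (max 0 (ε i - s i * MvPolynomial.eval x (P i)))) *
          (- (s i * MvPolynomial.eval x (MvPolynomial.pderiv j (P i))))) =
        -2 * ∑ i, K * (max 0 (ε i - s i * MvPolynomial.eval x (P i))) * s i *
        MvPolynomial.eval x (MvPolynomial.pderiv j (P i)) := by
      rw [Finset.mul_sum]
      exact Finset.sum_congr rfl fun i _ => by ring
    rw [h5] at h0
    linarith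

lemma totalDegree_pderiv_le {n : ℕ} (j : Fin n) (p : MvPolynomial (Fin n) ℝ) :
    (MvPolynomial.pderiv j p).totalDegree ≤ p.totalDegree := by
  conv_lhs => rw [p.as_sum, map_sum]
  refine MvPolynomial.totalDegree_finsetSum_le fun s hs => ?_
  rw [MvPolynomial.pderiv_monomial]
  refine (MvPolynomial.totalDegree_monomial_le _ _).trans ?_
  refine le_trans ?_ (MvPolynomial.le_totalDegree hs)
  rw [Finsupp.sum_fintype _ _ (fun _ => rfl), Finsupp.sum_fintype _ _ (fun _ => rfl)]
  exact Finset.sum_le_sum fun i _ => by simp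

/-- Existence of a point of a box where a nonzero polynomial does not vanish. -/
lemma exists_eval_ne_zero {n : ℕ} (p : MvPolynomial (Fin n) ℝ) (hp : p ≠ 0) (δ : ℝ) (hδ : 0 < δ) :
    ∃ v : Fin n → ℝ, (∀ i, v i ∈ Ioo 0 δ) ∧ MvPolynomial.eval v p ≠ 0 := by
  by_contra h
  push Not at h
  apply hp
  refine MvPolynomial.funext_set (fun _ => Ioo 0 δ) (fun _ => Ioo_infinite hδ) fun x hx => ?_
  rw [h x fun i => hx i (mem_univ i)]; simp

/-- The sign attached to a Boolean. -/
def sg (b : Bool) : ℝ := if b then 1 else -1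

lemma sg_abs (b : Bool) : |sg b| = 1 := by cases b <;> simp [sg]
lemma sg_sq (b : Bool) : sg b ^ 2 = 1 := by cases b <;> simp [sg]

/-- Generic thresholds. -/
lemma exists_thresholds {n N : ℕ} (P : Fin N → MvPolynomial (Fin n) ℝ) (δ : ℝ) (hδ : 0 < δ) :
    ∃ (ε : Fin N → ℝ) (η : ℝ), 0 < η ∧ (∀ i, η < ε i ∧ ε i < δ) ∧
      ∀ (σ : Fin N → Bool) (x : Fin n → ℝ) (A : Finset (Fin N)),
        (∀ i ∈ A, |sg (σ i) * MvPolynomial.eval x (P i) - ε i| ≤ η) → A.card ≤ n := by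
  classical
  choose R hR0 hR using fun f : Fin (n + 1) ↪ Fin N =>
    exists_alg_relation (fun k => P (f k) ^ 2)
  let Q : MvPolynomial (Fin N) ℝ := ∏ f : Fin (n + 1) ↪ Fin N, MvPolynomial.rename f (R f)
  have hQ : Q ≠ 0 := Finset.prod_ne_zero_iff.2 fun f _ h =>
    hR0 f (MvPolynomial.rename_injective f f.injective (by rw [h, map_zero]))
  obtain ⟨e, he, hQe⟩ := exists_eval_ne_zero Q hQ (δ ^ 2) (by positivity)
  let ε : Fin N → ℝ := fun i => √(e i)
  have hε2 : (fun i => ε i ^ 2) = e := funext fun i => Real.sq_sqrt (he i).1.le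
  have hεpos : ∀ i, 0 < ε i := fun i => Real.sqrt_pos.2 (he i).1
  have hεδ : ∀ i, ε i < δ := fun i => (Real.sqrt_lt' hδ).2 (he i).2
  have hc : Continuous fun w : Fin N → ℝ => MvPolynomial.eval (fun i => w i ^ 2) Q :=
    (MvPolynomial.continuous_eval Q).comp (by fun_prop)
  have hop : IsOpen {w : Fin N → ℝ | MvPolynomial.eval (fun i => w i ^ 2) Q ≠ 0} :=
    isOpen_ne_fun hc continuous_const
  obtain ⟨η0, hη0, hball⟩ := Metric.isOpen_iff.1 hop ε (by
    show MvPolynomial.eval (fun i => ε i ^ 2) Q ≠ 0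
    rw [hε2]; exact hQe)
  obtain ⟨η1, hη1, hη1'⟩ : ∃ η1 > 0, ∀ i, η1 < ε i := by
    rcases isEmpty_or_nonempty (Fin N) with h | h
    · exact ⟨1, one_pos, fun i => h.elim i⟩
    · obtain ⟨i0, h0⟩ := Finite.exists_min ε
      exact ⟨ε i0 / 2, half_pos (hεpos i0), fun i => by linarith [h0 i, hεpos i0]⟩
  refine ⟨ε, min η1 (η0 / 2), lt_min hη1 (half_pos hη0), fun i =>
    ⟨(min_le_left _ _).trans_lt (hη1' i), hεδ i⟩, ?_⟩
  intro σ x A hA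
  by_contra hcard
  push Not at hcard
  let w : Fin N → ℝ := fun i => if i ∈ A then sg (σ i) * MvPolynomial.eval x (P i) else ε i
  have hw : w ∈ Metric.ball ε η0 := by
    rw [Metric.mem_ball]
    refine lt_of_le_of_lt ?_ (half_lt_self hη0)
    refine (dist_pi_le_iff (half_pos hη0).le).2 fun i => ?_
    by_cases hi : i ∈ A
    · simp only [w, hi, if_true, Real.dist_eq]
      exact (hA i hi).trans (min_le_right _ _)
    · simp only [w, hi, if_false, dist_self]
      exact (half_pos hη0).le
  have hne : MvPolynomial.eval (fun i => w i ^ 2) Q ≠ 0 := hball hw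
  obtain ⟨f⟩ : Nonempty (Fin (n + 1) ↪ A) :=
    Function.Embedding.nonempty_of_card_le (by simpa using hcard)
  let g : Fin (n + 1) ↪ Fin N := f.trans (Function.Embedding.subtype _)
  apply hne
  simp only [Q, map_prod]
  refine Finset.prod_eq_zero (Finset.mem_univ g) ?_
  rw [MvPolynomial.eval_rename]
  have h1 := congrArg (MvPolynomial.eval x) (hR g)
  rw [MvPolynomial.map_aeval] at h1
  have : (MvPolynomial.eval x).comp (algebraMap ℝ (MvPolynomial (Fin n) ℝ)) = RingHom.id ℝ := by
    ext; simp [MvPolynomial.algebraMap_eq]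
  rw [this, map_zero] at h1
  have h2 : ((fun i => w i ^ 2) ∘ g) = fun k => MvPolynomial.eval x (P (g k) ^ 2) := by
    ext k
    have hk : g k ∈ A := (f k).2
    simp [w, hk, mul_pow, sg_sq]
  rw [h2]
  exact h1

/-- Warren-type bound: if all sign patterns occur then `2^N` is small. -/
lemma sign_count {n N d : ℕ} (hd : 1 ≤ d) (P : Fin N → MvPolynomial (Fin n) ℝ)
    (hP : ∀ i, (P i).totalDegree ≤ d)
    (hy : ∀ σ : Fin N → Bool, ∃ y, ∀ i, 0 < sg (σ i) * MvPolynomial.eval y (P i)) :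
    2 ^ N ≤ (2 * d + 1) ^ n * (Finset.univ.filter fun τ : Fin N → Option Bool =>
      (Finset.univ.filter fun i => τ i ≠ none).card ≤ n).card := by
  classical
  choose y hy using hy
  obtain ⟨δ, hδ, hδ'⟩ : ∃ δ > 0, ∀ z : (Fin N → Bool) × Fin N,
      δ ≤ sg (z.1 z.2) * MvPolynomial.eval (y z.1) (P z.2) := by
    rcases isEmpty_or_nonempty ((Fin N → Bool) × Fin N) with h | h
    · exact ⟨1, one_pos, fun i => h.elim i⟩
    · obtain ⟨i0, h0⟩ := Finite.exists_min fun z : (Fin N → Bool) × Fin N =>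
        sg (z.1 z.2) * MvPolynomial.eval (y z.1) (P z.2)
      exact ⟨_, hy i0.1 i0.2, h0⟩
  obtain ⟨ε, η, hη, hε, hA⟩ := exists_thresholds P δ hδ
  let B : ℝ := 1 + ∑ σ, ∑ j, (|y σ j| + 1) ^ 2
  have hBpos : 0 < B := by positivity
  let K : ℝ := B / η ^ 2
  have hK : 0 < K := by positivity
  let F : (Fin N → Option Bool) → Fin n → MvPolynomial (Fin n) ℝ := fun τ j =>
    MvPolynomial.X j - ∑ i, (τ i).elim 0 (fun b => MvPolynomial.C K *
      (MvPolynomial.C (ε i) - MvPolynomial.C (sg b) * P i) * MvPolynomial.C (sg b) *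
        MvPolynomial.pderiv j (P i))
  have hF : ∀ τ j, (F τ j).totalDegree ≤ 2 * d := by
    intro τ j
    refine (MvPolynomial.totalDegree_sub _ _).trans (max_le ?_ ?_)
    · rw [MvPolynomial.totalDegree_X]; omega
    · refine MvPolynomial.totalDegree_finsetSum_le fun i _ => ?_
      cases τ i with
      | none => simp
      | some b =>
        simp only [Option.elim_some]
        refine (MvPolynomial.totalDegree_mul _ _).trans ?_
        have h1 := (totalDegree_pderiv_le j (P i)).trans (hP i)
        have h2 : (MvPolynomial.C K *
            (MvPolynomial.C (ε i) - MvPolynomial.C (sg b) * P i) * MvPolynomial.C (sg b)).totalDegree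
            ≤ d := by
          refine (MvPolynomial.totalDegree_mul _ _).trans ?_
          rw [MvPolynomial.totalDegree_C, add_zero]
          refine (MvPolynomial.totalDegree_mul _ _).trans ?_
          rw [MvPolynomial.totalDegree_C, zero_add]
          refine (MvPolynomial.totalDegree_sub _ _).trans (max_le ?_ ?_)
          · rw [MvPolynomial.totalDegree_C]; omega
          · refine (MvPolynomial.totalDegree_mul _ _).trans ?_
            rw [MvPolynomial.totalDegree_C, zero_add]
            exact hP i
        omega
  choose p hp0 hp using fun τ => fibre_bound (F τ) (hF τ)
  obtain ⟨v, hv, hpv⟩ := exists_eval_ne_zero (∏ τ, p τ)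
    (Finset.prod_ne_zero_iff.2 fun τ _ => hp0 τ) 1 one_pos
  rw [map_prod, Finset.prod_ne_zero_iff] at hpv
  choose x hx1 hx2 using fun σ : Fin N → Bool =>
    exists_penalty_min P (fun i => sg (σ i)) ε K hK v
  have hxη : ∀ σ i, max 0 (ε i - sg (σ i) * MvPolynomial.eval (x σ) (P i)) ≤ η := by
    intro σ i
    have h1 := hx1 σ (y σ) (fun i => (hε i).2.le.trans (hδ' (σ, i))) i
    have h2 : ∑ j, (y σ j - v j) ^ 2 ≤ B := by
      have h3 : ∑ j, (y σ j - v j) ^ 2 ≤ ∑ j, (|y σ j| + 1) ^ 2 := by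
        refine Finset.sum_le_sum fun j _ => ?_
        refine sq_le_sq' ?_ ?_
        · have := neg_abs_le (y σ j)
          linarith [(hv j).2]
        · have := le_abs_self (y σ j)
          linarith [(hv j).1]
      have h4 := Finset.single_le_sum (f := fun σ => ∑ j, (|y σ j| + 1) ^ 2)
        (fun σ _ => Finset.sum_nonneg fun j _ => sq_nonneg _) (Finset.mem_univ σ)
      simp only [B]
      linarith
    have h5 := h1.trans h2
    have h6 : (max 0 (ε i - sg (σ i) * MvPolynomial.eval (x σ) (P i))) ^ 2 ≤ η ^ 2 := by
      have h7 : B = K * η ^ 2 := by simp only [K]; field_simp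
      rw [h7] at h5
      exact le_of_mul_le_mul_left h5 hK
    exact (sq_le_sq₀ (le_max_left _ _) hη.le).1 h6
  have hxpos : ∀ σ i, 0 < sg (σ i) * MvPolynomial.eval (x σ) (P i) := by
    intro σ i
    have h1 := (le_max_right _ _).trans (hxη σ i)
    linarith [(hε i).1]
  have hxinj : Function.Injective x := by
    intro σ σ' h
    ext i
    have h1 := hxpos σ i
    have h2 := hxpos σ' i
    rw [← h] at h2
    cases h3 : σ i <;> cases h4 : σ' i <;> simp [h3, h4, sg] at h1 h2 ⊢ <;> linarith
  let act : (Fin N → Bool) → Fin N → Option Bool := fun σ i =>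
    if 0 < ε i - sg (σ i) * MvPolynomial.eval (x σ) (P i) then some (σ i) else none
  have hcard : (Finset.univ : Finset (Fin N → Bool)).card = 2 ^ N := by simp
  rw [← hcard]
  refine Finset.card_le_mul_card_image_of_maps_to (f := act) ?_ _ ?_
  · intro σ _
    refine Finset.mem_filter.2 ⟨Finset.mem_univ _, ?_⟩
    refine hA σ (x σ) _ fun i hi => ?_
    have hi' : 0 < ε i - sg (σ i) * MvPolynomial.eval (x σ) (P i) := by
      by_contra hcon
      have := (Finset.mem_filter.1 hi).2
      exact this (if_neg hcon)
    rw [abs_sub_comm, abs_of_pos hi']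
    exact (le_max_right _ _).trans (hxη σ i)
  · intro τ _
    rw [← Finset.card_image_of_injective _ hxinj]
    refine hp τ v (hpv τ (Finset.mem_univ τ)) _ fun z hz j => ?_
    obtain ⟨σ, hσ, rfl⟩ := Finset.mem_image.1 hz
    have hτ : act σ = τ := (Finset.mem_filter.1 hσ).2
    rw [← hx2 σ j]
    simp only [F, map_sub, map_sum, MvPolynomial.eval_X]
    congr 1
    refine Finset.sum_congr rfl fun i _ => ?_
    rw [← hτ]
    by_cases h : 0 < ε i - sg (σ i) * MvPolynomial.eval (x σ) (P i)
    · simp only [act, h, if_true, Option.elim_some, max_eq_right h.le]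
      simp
    · simp only [act, h, if_false, Option.elim_none, max_eq_left (not_lt.1 h)]
      simp

lemma card_patterns (n N : ℕ) :
    ((Finset.univ.filter fun τ : Fin N → Option Bool =>
      (Finset.univ.filter fun i => τ i ≠ none).card ≤ n).card : ℝ) ≤ 8 ^ n * (5 / 4 : ℝ) ^ N := by
  classical
  let w : Option Bool → ℝ := fun o => o.elim 1 (fun _ => 1 / 8)
  have hw : ∀ τ : Fin N → Option Bool, ∏ i, w (τ i) =
      (1 / 8 : ℝ) ^ (Finset.univ.filter fun i => τ i ≠ none).card := by
    intro τ
    rw [← Finset.prod_const, Finset.prod_filter]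
    refine Finset.prod_congr rfl fun i _ => ?_
    cases τ i <;> simp [w]
  have hsum : ∑ τ : Fin N → Option Bool, ∏ i, w (τ i) = (5 / 4 : ℝ) ^ N := by
    rw [← Fintype.prod_sum (fun (_ : Fin N) o => w o)]
    simp [w, Fintype.sum_option]
    norm_num
  have h1 : ((Finset.univ.filter fun τ : Fin N → Option Bool =>
      (Finset.univ.filter fun i => τ i ≠ none).card ≤ n).card : ℝ) * (1 / 8) ^ n ≤ (5 / 4 : ℝ) ^ N := by
    rw [← hsum, ← nsmul_eq_mul, ← Finset.sum_const]
    refine (Finset.sum_le_sum (g := fun τ => ∏ i, w (τ i)) fun τ hτ => ?_).trans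
      (Finset.sum_le_sum_of_subset_of_nonneg (Finset.filter_subset _ _) fun τ _ _ => ?_)
    · rw [hw]
      exact pow_le_pow_of_le_one (by norm_num) (by norm_num) (Finset.mem_filter.1 hτ).2
    · rw [hw]; positivity
  have h2 : (8:ℝ) ^ n * (1 / 8) ^ n = 1 := by rw [← mul_pow]; norm_num
  calc _ = (8:ℝ) ^ n * (_ * (1 / 8) ^ n) := by rw [mul_left_comm, h2, mul_one]
    _ ≤ _ := by gcongr

/-- Some sign vector is not realised. -/
lemma exists_sign {n N d : ℕ} (hn : 1 ≤ n) (hd : 2 ≤ d) (hN : 20 * (n * Real.log d) ≤ N)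
    (P : Fin N → MvPolynomial (Fin n) ℝ) (hP : ∀ i, (P i).totalDegree ≤ d) :
    ∃ σ : Fin N → Bool, ∀ y, ∃ i, sg (σ i) * MvPolynomial.eval y (P i) ≤ 0 := by
  by_contra hcon
  push Not at hcon
  have h1 := sign_count (by omega) P hP hcon
  have h2 : (2:ℝ) ^ N ≤ (2 * d + 1) ^ n * (8 ^ n * (5 / 4 : ℝ) ^ N) := by
    have : (2:ℝ) ^ N ≤ (2 * d + 1) ^ n * ((Finset.univ.filter fun τ : Fin N → Option Bool =>
      (Finset.univ.filter fun i => τ i ≠ none).card ≤ n).card : ℝ) := by exact_mod_cast h1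
    refine this.trans ?_
    gcongr
    exact card_patterns n N
  have hd' : (2:ℝ) ≤ d := by exact_mod_cast hd
  have hlog : 0 < Real.log d := Real.log_pos (by linarith)
  have hn' : (1:ℝ) ≤ n := by exact_mod_cast hn
  have h3 := Real.log_le_log (by positivity) h2
  rw [Real.log_mul (by positivity) (by positivity), Real.log_mul (by positivity) (by positivity),
    Real.log_pow, Real.log_pow, Real.log_pow, Real.log_pow] at h3
  have h4 : Real.log (2 * d + 1) + Real.log 8 ≤ 6 * Real.log d := by
    rw [← Real.log_mul (by positivity) (by positivity)]
    have : 6 * Real.log d = Real.log ((d:ℝ) ^ 6) := by rw [Real.log_pow]; norm_num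
    rw [this]
    refine Real.log_le_log (by positivity) ?_
    have h5 : (2:ℝ) ^ 5 ≤ (d:ℝ) ^ 5 := by gcongr
    nlinarith
  have h6 : (3/8 : ℝ) ≤ Real.log 2 - Real.log (5 / 4) := by
    rw [← Real.log_div (by norm_num) (by norm_num)]
    have := Real.one_sub_inv_le_log_of_pos (x := 2 / (5 / 4)) (by norm_num)
    norm_num at this ⊢
    linarith
  have h7 : (N:ℝ) * (3 / 8) ≤ n * (6 * Real.log d) := by
    have := mul_le_mul_of_nonneg_left h6 (Nat.cast_nonneg (α := ℝ) N)
    have := mul_le_mul_of_nonneg_left h4 (Nat.cast_nonneg (α := ℝ) n)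
    linarith
  have h8 : 0 < (n:ℝ) * Real.log d := by positivity
  linarith

lemma contDiff_posPow (k : ℕ) : ContDiff ℝ k (fun y : ℝ => (max 0 y) ^ (k + 1)) := by
  induction k with
  | zero =>
    simp only [Nat.cast_zero, contDiff_zero]
    fun_prop
  | succ k ih =>
    push_cast
    rw [contDiff_succ_iff_deriv]
    refine ⟨fun x => (hasDerivAt_posPow k x).differentiableAt, by simp, ?_⟩
    have : deriv (fun y : ℝ => (max 0 y) ^ (k + 1 + 1)) =
        fun x => (k + 2 : ℝ) * (max 0 x) ^ (k + 1) :=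
      funext fun x => (hasDerivAt_posPow k x).deriv
    rw [this]
    exact contDiff_const.mul ih

lemma iteratedDeriv_posPow (p k : ℕ) (hk : k + 1 ≤ p) :
    iteratedDeriv k (fun y : ℝ => (max 0 y) ^ p) =
      fun y => (p.descFactorial k : ℝ) * (max 0 y) ^ (p - k) := by
  induction k with
  | zero => simp
  | succ k ih =>
    rw [iteratedDeriv_succ, ih (by omega)]
    ext y
    obtain ⟨q, hq⟩ : ∃ q, p - k = q + 2 := ⟨p - k - 2, by omega⟩
    have h1 := (hasDerivAt_posPow q y).const_mul (p.descFactorial k : ℝ)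
    rw [hq, h1.deriv, Nat.descFactorial_succ, hq, show p - (k + 1) = q + 1 by omega]
    push_cast
    ring

/-- The bump function `(1-x²)₊^p`. -/
def bump (p : ℕ) (x : ℝ) : ℝ := (max 0 (1 - x)) ^ p * (max 0 (1 + x)) ^ p

lemma contDiff_bump (k : ℕ) : ContDiff ℝ k (bump (k + 1)) := by
  have h := contDiff_posPow k
  exact (h.comp (contDiff_const.sub contDiff_id)).mul (h.comp (contDiff_const.add contDiff_id))

lemma iteratedDeriv_bump_le (m k : ℕ) (hk : k ≤ m + 1) (x : ℝ) :
    |iteratedDeriv k (bump (m + 2)) x| ≤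
      if |x| < 1 then (2 * ((m : ℝ) + 2)) ^ k else 0 := by
  have hcd : ContDiff ℝ k (fun y : ℝ => (max 0 y) ^ (m + 2)) :=
    (contDiff_posPow (m + 1)).of_le (by exact_mod_cast hk)
  have h1 : ContDiff ℝ k (fun x : ℝ => (max 0 (1 - x)) ^ (m + 2)) :=
    hcd.comp (contDiff_const.sub contDiff_id)
  have h2 : ContDiff ℝ k (fun x : ℝ => (max 0 (1 + x)) ^ (m + 2)) :=
    hcd.comp (contDiff_const.add contDiff_id)
  have h3 : iteratedDeriv k (bump (m + 2)) x = ∑ i ∈ Finset.range (k + 1),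
      k.choose i * iteratedDeriv i (fun x : ℝ => (max 0 (1 - x)) ^ (m + 2)) x *
        iteratedDeriv (k - i) (fun x : ℝ => (max 0 (1 + x)) ^ (m + 2)) x :=
    iteratedDeriv_fun_mul h1.contDiffAt h2.contDiffAt
  set a := max 0 (1 - x) with ha
  set c := max 0 (1 + x) with hc
  have ha0 : 0 ≤ a := le_max_left _ _
  have hc0 : 0 ≤ c := le_max_left _ _
  have h4 : |iteratedDeriv k (bump (m + 2)) x| ≤
      ((m:ℝ) + 2) ^ k * (a * c) ^ (m + 2 - k) * (a + c) ^ k := by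
    rw [h3]
    refine (Finset.abs_sum_le_sum_abs _ _).trans ?_
    rw [add_comm a c, add_pow c a k, Finset.mul_sum]
    refine Finset.sum_le_sum fun i hi => ?_
    have hik : i ≤ k := by have := Finset.mem_range.1 hi; omega
    have e1 : iteratedDeriv i (fun x : ℝ => (max 0 (1 - x)) ^ (m + 2)) x =
        (-1) ^ i * (((m + 2).descFactorial i : ℝ) * a ^ (m + 2 - i)) := by
      have := congrFun (iteratedDeriv_comp_const_sub i (fun y : ℝ => (max 0 y) ^ (m + 2)) (1:ℝ)) x
      rw [this, iteratedDeriv_posPow _ _ (by omega)]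
      simp [ha]
    have e2 : iteratedDeriv (k - i) (fun x : ℝ => (max 0 (1 + x)) ^ (m + 2)) x =
        (((m + 2).descFactorial (k - i) : ℝ) * c ^ (m + 2 - (k - i))) := by
      have := congrFun (iteratedDeriv_comp_const_add (k - i) (fun y : ℝ => (max 0 y) ^ (m + 2)) (1:ℝ)) x
      rw [this, iteratedDeriv_posPow _ _ (by omega)]
    rw [e1, e2]
    have d1 : ((m + 2).descFactorial i : ℝ) ≤ ((m:ℝ) + 2) ^ i := by
      exact_mod_cast Nat.descFactorial_le_pow (m + 2) i
    have d2 : ((m + 2).descFactorial (k - i) : ℝ) ≤ ((m:ℝ) + 2) ^ (k - i) := by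
      exact_mod_cast Nat.descFactorial_le_pow (m + 2) (k - i)
    rw [abs_mul, abs_mul, abs_mul, abs_pow, abs_neg, abs_one, one_pow, one_mul,
      abs_of_nonneg (by positivity : (0:ℝ) ≤ (k.choose i : ℝ)),
      abs_of_nonneg (by positivity : 0 ≤ ((m + 2).descFactorial i : ℝ) * a ^ (m + 2 - i)),
      abs_of_nonneg (by positivity : 0 ≤ ((m + 2).descFactorial (k - i) : ℝ) * c ^ (m + 2 - (k - i)))]
    have f1 : ((m:ℝ) + 2) ^ k = ((m:ℝ) + 2) ^ i * ((m:ℝ) + 2) ^ (k - i) := by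
      rw [← pow_add]; congr 1; omega
    have f2 : a ^ (m + 2 - i) = a ^ (m + 2 - k) * a ^ (k - i) := by
      rw [← pow_add]; congr 1; omega
    have f3 : c ^ (m + 2 - (k - i)) = c ^ (m + 2 - k) * c ^ i := by
      rw [← pow_add]; congr 1; omega
    rw [f1, f2, f3, mul_pow]
    calc _ ≤ (k.choose i : ℝ) * (((m:ℝ) + 2) ^ i * (a ^ (m + 2 - k) * a ^ (k - i))) *
          (((m:ℝ) + 2) ^ (k - i) * (c ^ (m + 2 - k) * c ^ i)) := by gcongr
      _ = _ := by ring
  refine h4.trans ?_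
  by_cases hx : |x| < 1
  · rw [if_pos hx]
    obtain ⟨hx1, hx2⟩ := abs_lt.1 hx
    have ea : a = 1 - x := max_eq_right (by linarith)
    have ec : c = 1 + x := max_eq_right (by linarith)
    have hac : (a * c) ^ (m + 2 - k) ≤ 1 := by
      refine pow_le_one₀ (by positivity) ?_
      rw [ea, ec]; nlinarith [sq_nonneg x]
    have : a + c = 2 := by rw [ea, ec]; ring
    rw [this, mul_pow 2]
    calc _ ≤ ((m:ℝ) + 2) ^ k * 1 * 2 ^ k := by gcongr
      _ = _ := by ring
  · rw [if_neg hx]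
    have hac : a * c = 0 := by
      rcases le_or_gt 1 x with h | h
      · rw [show a = 0 from max_eq_left (by linarith), zero_mul]
      · have : x ≤ -1 := by
          by_contra hcon
          push Not at hcon
          exact hx (abs_lt.2 ⟨hcon, h⟩)
        rw [show c = 0 from max_eq_left (by linarith), mul_zero]
    rw [hac, zero_pow (by omega)]
    simp

lemma bump_zero (p : ℕ) : bump p 0 = 1 := by simp [bump]

lemma bump_nonneg (p : ℕ) (x : ℝ) : 0 ≤ bump p x := by unfold bump; positivity

lemma bump_far (m : ℕ) (x : ℝ) (hx : 1 ≤ |x|) : bump (m + 2) x = 0 := by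
  have := iteratedDeriv_bump_le m 0 (by omega) x
  rw [if_neg (not_lt.2 hx), iteratedDeriv_zero] at this
  exact abs_nonpos_iff.1 this

lemma holder_of_bounds (m : ℕ) (α : ℝ) (hα0 : 0 < α) (hα1 : α ≤ 1) (f : ℝ → ℝ)
    (hf : ContDiff ℝ (m + 1 : ℕ) f) (S r : ℝ) (hS : 0 ≤ S) (hr : 0 < r) (hr1 : r ≤ 1)
    (hSr : 2 * S ≤ r ^ ((m:ℝ) + α))
    (hb : ∀ k ≤ m + 1, ∀ x, |iteratedDeriv k f x| ≤ S / r ^ k) : HolderClass1 m α f := by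
  have hu : UniqueDiffOn ℝ I01 := uniqueDiffOn_Icc one_pos
  have hw : ∀ j ≤ m, ∀ x ∈ I01, iteratedDerivWithin j f I01 x = iteratedDeriv j f x := by
    intro j hj x hx
    refine iteratedDerivWithin_eq_iteratedDeriv hu ?_ hx
    exact (hf.of_le (by exact_mod_cast (by omega : j ≤ m + 1))).contDiffAt
  have hrl : r ^ ((m:ℝ) + α) = r ^ m * r ^ α := by
    rw [Real.rpow_add hr, Real.rpow_natCast]
  have hra : r ^ α ≤ 1 := Real.rpow_le_one hr.le hr1 hα0.le
  have hrapos : 0 < r ^ α := Real.rpow_pos_of_pos hr _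
  have hrm : 0 < r ^ m := pow_pos hr m
  refine ⟨(hf.of_le (by exact_mod_cast Nat.le_succ m)).contDiffOn, ?_, ?_⟩
  · intro j hj x hx
    rw [hw j hj x hx]
    refine (hb j (by omega) x).trans ?_
    rw [div_le_one (by positivity)]
    have h1 : r ^ m ≤ r ^ j := pow_le_pow_of_le_one hr.le hr1 hj
    have h2 : r ^ m * r ^ α ≤ r ^ m := mul_le_of_le_one_right hrm.le hra
    rw [hrl] at hSr
    linarith
  · intro x hx y hy
    rw [hw m le_rfl x hx, hw m le_rfl y hy]
    set t := |x - y| with ht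
    have ht0 : 0 ≤ t := abs_nonneg _
    rcases le_or_gt t r with htr | htr
    · have hlip : |iteratedDeriv m f x - iteratedDeriv m f y| ≤ S / r ^ (m + 1) * t := by
        have hdiff : Differentiable ℝ (iteratedDeriv m f) :=
          hf.differentiable_iteratedDeriv m (by exact_mod_cast Nat.lt_succ_self m)
        have := (convex_univ (𝕜 := ℝ) (E := ℝ)).norm_image_sub_le_of_norm_deriv_le
          (f := iteratedDeriv m f) (C := S / r ^ (m + 1)) (fun z _ => hdiff z)
          (fun z _ => by
            rw [← iteratedDeriv_succ]
            exact hb (m + 1) le_rfl z) (mem_univ y) (mem_univ x)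
        simpa [Real.norm_eq_abs] using this
      refine hlip.trans ?_
      rcases ht0.eq_or_lt with h0 | h0
      · rw [← h0, mul_zero]; positivity
      · have e1 : t = t ^ α * t ^ (1 - α) := by
          rw [← Real.rpow_add h0]; simp
        have e2 : r = r ^ α * r ^ (1 - α) := by
          rw [← Real.rpow_add hr]; simp
        have h3 : t ^ (1 - α) ≤ r ^ (1 - α) := Real.rpow_le_rpow ht0 htr (by linarith)
        have hta : 0 ≤ t ^ α := by positivity
        have h4 : S / r ^ (m + 1) * r ^ (1 - α) ≤ 1 := by
          have : S / r ^ (m + 1) * r ^ (1 - α) = S / (r ^ m * r ^ α) := by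
            have hpos : 0 < r ^ (1 - α) := Real.rpow_pos_of_pos hr _
            have : r ^ (m + 1) = r ^ m * r ^ α * r ^ (1 - α) := by
              rw [mul_assoc, ← e2, pow_succ]
            rw [this]
            field_simp
          rw [this, div_le_one (by positivity), ← hrl]
          linarith
        calc S / r ^ (m + 1) * t = S / r ^ (m + 1) * (t ^ α * t ^ (1 - α)) := by rw [← e1]
          _ ≤ S / r ^ (m + 1) * (t ^ α * r ^ (1 - α)) := by gcongr
          _ = (S / r ^ (m + 1) * r ^ (1 - α)) * t ^ α := by ring
          _ ≤ 1 * t ^ α := by gcongr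
          _ = t ^ α := one_mul _
    · have h1 := hb m (by omega) x
      have h2 := hb m (by omega) y
      have h3 : |iteratedDeriv m f x - iteratedDeriv m f y| ≤ 2 * S / r ^ m := by
        refine (abs_sub _ _).trans ?_
        rw [mul_div_assoc]; linarith
      refine h3.trans ?_
      have h4 : r ^ α ≤ t ^ α := Real.rpow_le_rpow hr.le htr.le hα0.le
      refine le_trans ?_ h4
      rw [div_le_iff₀ hrm]
      rw [hrl] at hSr
      linarith [mul_comm (r ^ m) (r ^ α)]

/-- The sum of signed bumps. -/
def bumpSum (m N : ℕ) (a : Fin N → ℝ) (x : Fin N → ℝ) (r : ℝ) (y : ℝ) : ℝ :=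
  ∑ i, a i * bump (m + 2) (r⁻¹ * (y - x i))

lemma bump_scaled (m k : ℕ) (hk : k ≤ m + 1) (r x₀ y : ℝ) :
    iteratedDeriv k (fun y => bump (m + 2) (r⁻¹ * (y - x₀))) y =
      r⁻¹ ^ k * iteratedDeriv k (bump (m + 2)) (r⁻¹ * (y - x₀)) := by
  have hcd : ContDiff ℝ k (bump (m + 2)) :=
    (contDiff_bump (m + 1)).of_le (by exact_mod_cast hk)
  have h1 := congrFun (iteratedDeriv_comp_sub_const k (fun z => bump (m + 2) (r⁻¹ * z)) x₀) y
  rw [h1, iteratedDeriv_comp_const_mul hcd]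

lemma contDiff_bumpSum (m N : ℕ) (a : Fin N → ℝ) (x : Fin N → ℝ) (r : ℝ) :
    ContDiff ℝ (m + 1 : ℕ) (bumpSum m N a x r) := by
  unfold bumpSum
  refine ContDiff.sum fun i _ => contDiff_const.mul ?_
  exact (contDiff_bump (m + 1)).comp (contDiff_const.mul (contDiff_id.sub contDiff_const))

lemma bumpSum_deriv_le (m N : ℕ) (a : Fin N → ℝ) (x : Fin N → ℝ) (r H : ℝ) (hr : 0 < r)
    (hH : 0 ≤ H) (ha : ∀ i, |a i| = H) (hx : ∀ i j, i ≠ j → 2 * r ≤ |x i - x j|)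
    (k : ℕ) (hk : k ≤ m + 1) (y : ℝ) :
    |iteratedDeriv k (bumpSum m N a x r) y| ≤ H * (2 * ((m:ℝ) + 2)) ^ k / r ^ k := by
  have hcd : ∀ i, ContDiff ℝ k (fun y => a i * bump (m + 2) (r⁻¹ * (y - x i))) := by
    intro i
    refine contDiff_const.mul ?_
    exact ((contDiff_bump (m + 1)).of_le (by exact_mod_cast hk)).comp
      (contDiff_const.mul (contDiff_id.sub contDiff_const))
  have h1 : iteratedDeriv k (bumpSum m N a x r) y =
      ∑ i, a i * (r⁻¹ ^ k * iteratedDeriv k (bump (m + 2)) (r⁻¹ * (y - x i))) := by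
    unfold bumpSum
    rw [iteratedDeriv_fun_sum fun i _ => (hcd i).contDiffAt]
    refine Finset.sum_congr rfl fun i _ => ?_
    rw [iteratedDeriv_const_mul_field, bump_scaled m k hk]
  rw [h1]
  have hfar : ∀ i, r ≤ |y - x i| → iteratedDeriv k (bump (m + 2)) (r⁻¹ * (y - x i)) = 0 := by
    intro i hi
    have := iteratedDeriv_bump_le m k hk (r⁻¹ * (y - x i))
    rw [if_neg] at this
    · exact abs_nonpos_iff.1 this
    · rw [not_lt, abs_mul, abs_of_pos (inv_pos.2 hr), inv_mul_eq_div, one_le_div hr]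
      exact hi
  by_cases hex : ∃ i, |y - x i| < r
  · obtain ⟨i, hi⟩ := hex
    rw [Finset.sum_eq_single i]
    · rw [abs_mul, abs_mul, ha, abs_of_pos (by positivity : 0 < r⁻¹ ^ k)]
      have h2 : |iteratedDeriv k (bump (m + 2)) (r⁻¹ * (y - x i))| ≤ (2 * ((m:ℝ) + 2)) ^ k := by
        refine (iteratedDeriv_bump_le m k hk _).trans ?_
        split_ifs
        · exact le_rfl
        · positivity
      calc _ ≤ H * (r⁻¹ ^ k * (2 * ((m:ℝ) + 2)) ^ k) := by gcongr
        _ = _ := by rw [inv_pow]; ring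
    · intro j _ hj
      rw [hfar j, mul_zero, mul_zero]
      have h3 := hx i j (Ne.symm hj)
      have h4 : |x i - x j| ≤ |y - x i| + |y - x j| := by
        have := abs_sub (y - x j) (y - x i)
        rw [show y - x j - (y - x i) = x i - x j by ring] at this
        linarith
      linarith
    · simp
  · push Not at hex
    rw [Finset.sum_eq_zero]
    · rw [abs_zero]; positivity
    · intro i _
      rw [hfar i (hex i), mul_zero, mul_zero]

lemma bumpSum_center (m N : ℕ) (a : Fin N → ℝ) (x : Fin N → ℝ) (r : ℝ) (hr : 0 < r)
    (hx : ∀ i j, i ≠ j → 2 * r ≤ |x i - x j|) (i : Fin N) : bumpSum m N a x r (x i) = a i := by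
  unfold bumpSum
  rw [Finset.sum_eq_single i]
  · simp [bump_zero]
  · intro j _ hj
    rw [bump_far, mul_zero]
    rw [abs_mul, abs_of_pos (inv_pos.2 hr), inv_mul_eq_div, one_le_div hr]
    linarith [hx i j (Ne.symm hj)]
  · simp

lemma Cinf1_pos (m : ℕ) (α : ℝ) : 0 < Cinf1 m α := by unfold Cinf1; positivity

lemma Cinf1_bound (m : ℕ) (hm : 1 ≤ m) (α : ℝ) (hα1 : α ≤ 1) :
    2 * (Cinf1 m α * (2 * ((m:ℝ) + 2)) ^ (m + 1)) * (64:ℝ) ^ ((m:ℝ) + α) ≤ 1 := by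
  have hm' : (1:ℝ) ≤ m := by exact_mod_cast hm
  have h64 : (64:ℝ) ^ ((m:ℝ) + α) = 2 ^ ((m:ℝ) + α) * 8 ^ ((m:ℝ) + α) * 4 ^ ((m:ℝ) + α) := by
    rw [← Real.mul_rpow (by norm_num) (by norm_num), ← Real.mul_rpow (by norm_num) (by norm_num)]
    norm_num
  have h4 : (4:ℝ) ^ ((m:ℝ) + α) ≤ 4 ^ (m + 1) := by
    rw [← Real.rpow_natCast]
    refine Real.rpow_le_rpow_of_exponent_le (by norm_num) ?_
    push_cast; linarith
  have h2 : (2:ℝ) ^ ((m:ℝ) + α + 1) = 2 ^ ((m:ℝ) + α) * 2 := by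
    rw [Real.rpow_add (by norm_num), Real.rpow_one]
  have he : (2:ℝ) ≤ Real.exp 1 := by
    have := Real.add_one_le_exp (1:ℝ)
    linarith
  have hkey : (2 * ((m:ℝ) + 2)) ^ (m + 1) * 4 ^ (m + 1) ≤
      ((m:ℝ) + 1) ^ (m + 1) * (4 * (1 + Real.exp 1)) ^ (m + 1) := by
    rw [← mul_pow, ← mul_pow]
    refine pow_le_pow_left₀ (by positivity) ?_ _
    nlinarith
  unfold Cinf1
  rw [h64, h2]
  have p1 : 0 < (2:ℝ) ^ ((m:ℝ) + α) := by positivity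
  have p2 : 0 < (8:ℝ) ^ ((m:ℝ) + α) := by positivity
  have p3 : 0 < ((m:ℝ) + 1) ^ (m + 1) * (4 * (1 + Real.exp 1)) ^ (m + 1) := by positivity
  generalize (2:ℝ) ^ ((m:ℝ) + α) = A at *
  generalize (8:ℝ) ^ ((m:ℝ) + α) = B at *
  have : 2 * (1 / (A * 2 * B * ((m:ℝ) + 1) ^ (m + 1) * (4 * (1 + Real.exp 1)) ^ (m + 1)) *
      (2 * ((m:ℝ) + 2)) ^ (m + 1)) * (A * B * 4 ^ ((m:ℝ) + α)) =
      ((2 * ((m:ℝ) + 2)) ^ (m + 1) * 4 ^ ((m:ℝ) + α)) /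
        (((m:ℝ) + 1) ^ (m + 1) * (4 * (1 + Real.exp 1)) ^ (m + 1)) := by
    have q1 : ((m:ℝ) + 1) ^ (m + 1) ≠ 0 := by positivity
    have q2 : (4 * (1 + Real.exp 1)) ^ (m + 1) ≠ 0 := by positivity
    generalize ((m:ℝ) + 1) ^ (m + 1) = Y at *
    generalize (4 * (1 + Real.exp 1)) ^ (m + 1) = Z at *
    generalize (4:ℝ) ^ ((m:ℝ) + α) = W at *
    generalize (2 * ((m:ℝ) + 2)) ^ (m + 1) = V at *
    field_simp
  rw [this, div_le_one p3]
  refine le_trans ?_ hkey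
  gcongr

/-- **Refined Vitushkin lower bound in dimension one.** For `l = m + α > 1` and any family
`P(x,ζ) = Σ_{|k| ≤ d} c_k(x) ζ^k` with continuous coefficients on `[0,1]`, there is
`h ∈ Λ_l([0,1]) ∩ C^m([0,1])`, vanishing identically on `[0,1/20]`, such that for every
`ζ ∈ ℝⁿ` there is a point `x(ζ) ∈ [0,1]` with
`C_∞(l,1)/(n log d)^l ≤ |h(x(ζ))| = ‖h‖_∞ ≤ 2^l C_∞(l,1)/(n log d)^l` and
`h(x(ζ)) · P(x(ζ),ζ) ≤ 0`. -/
theorem stmt_2 (m : ℕ) (hm : 1 ≤ m) (α : ℝ) (hα0 : 0 < α) (hα1 : α ≤ 1)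
    (n d : ℕ) (hn : 1 ≤ n) (hd : 2 ≤ d)
    (c : (Fin n → ℕ) → ℝ → ℝ) (hc : ∀ k ∈ degSet n d, ContinuousOn (c k) I01) :
    ∃ h : ℝ → ℝ, HolderClass1 m α h ∧ (∀ x ∈ Icc (0:ℝ) (1/20), h x = 0) ∧
      ∀ ζ : Fin n → ℝ, ∃ x ∈ I01,
        (Cinf1 m α / ((n : ℝ) * Real.log d) ^ ((m:ℝ) + α) ≤ |h x|) ∧
        (∀ y ∈ I01, |h y| ≤ |h x|) ∧
        (|h x| ≤ (2:ℝ) ^ ((m:ℝ) + α) * Cinf1 m α / ((n : ℝ) * Real.log d) ^ ((m:ℝ) + α)) ∧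
        h x * (∑ k ∈ degSet n d, c k x * ∏ i, ζ i ^ k i) ≤ 0 := by
  have hd' : (2:ℝ) ≤ d := by exact_mod_cast hd
  have hn' : (1:ℝ) ≤ n := by exact_mod_cast hn
  set E : ℝ := (n:ℝ) * Real.log d with hE
  have hE1 : (1/2:ℝ) ≤ E := by
    have h1 : Real.log 2 ≤ Real.log d := Real.log_le_log (by norm_num) hd'
    have h2 := Real.log_two_gt_d9
    nlinarith
  have hE0 : 0 < E := by linarith
  set l : ℝ := (m:ℝ) + α with hl
  obtain ⟨N, hN1, hN2⟩ : ∃ N : ℕ, 20 * E ≤ N ∧ (N:ℝ) ≤ 20 * E + 1 :=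
    ⟨⌈20 * E⌉₊, Nat.le_ceil _, (Nat.ceil_lt_add_one (by positivity)).le⟩
  set r : ℝ := 1 / (64 * E) with hr
  have hr0 : 0 < r := by positivity
  have hrE : r * (64 * E) = 1 := by rw [hr]; field_simp
  have hr1 : r ≤ 1 := by rw [hr, div_le_one (by positivity)]; linarith
  set H : ℝ := Cinf1 m α / E ^ l with hH
  have hEl : 0 < E ^ l := by positivity
  have hH0 : 0 < H := div_pos (Cinf1_pos m α) hEl
  let x : Fin N → ℝ := fun i => 1 / 20 + (2 * ((i : ℕ) : ℝ) + 1) * r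
  have hxI : ∀ i, x i ∈ I01 := by
    intro i
    have hi : ((i : ℕ) : ℝ) + 1 ≤ N := by exact_mod_cast i.2
    have hi0 : (0:ℝ) ≤ ((i : ℕ) : ℝ) := Nat.cast_nonneg _
    refine ⟨by positivity, ?_⟩
    have h1 : (2 * ((i : ℕ) : ℝ) + 1) * r ≤ (2 * (20 * E + 1)) * r := by
      gcongr
      linarith
    have h2 : (2 * (20 * E + 1)) * r = 40 / 64 + 2 * r := by
      linear_combination (40 / 64) * hrE
    have h3 : r ≤ 1 / 32 := by
      nlinarith
    show 1 / 20 + (2 * ((i : ℕ) : ℝ) + 1) * r ≤ 1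
    linarith
  have hxsep : ∀ i j, i ≠ j → 2 * r ≤ |x i - x j| := by
    intro i j hij
    have h1 : x i - x j = 2 * r * (((i : ℕ) : ℝ) - ((j : ℕ) : ℝ)) := by simp only [x]; ring
    have h2 : (1:ℝ) ≤ |((i : ℕ) : ℝ) - ((j : ℕ) : ℝ)| := by
      have h3 : (((i : ℕ) : ℤ) - ((j : ℕ) : ℤ)) ≠ 0 := by
        intro h
        exact hij (Fin.ext (by omega))
      have h4 := Int.one_le_abs h3
      exact_mod_cast h4
    rw [h1, abs_mul, abs_of_pos (by positivity)]
    nlinarith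
  let P : Fin N → MvPolynomial (Fin n) ℝ := fun i =>
    ∑ k ∈ degSet n d, MvPolynomial.C (c k (x i)) * ∏ j, MvPolynomial.X j ^ k j
  have hP : ∀ i, (P i).totalDegree ≤ d := by
    intro i
    refine MvPolynomial.totalDegree_finsetSum_le fun k hk => ?_
    refine (MvPolynomial.totalDegree_mul _ _).trans ?_
    rw [MvPolynomial.totalDegree_C, zero_add]
    refine (MvPolynomial.totalDegree_finsetProd _ _).trans ?_
    refine le_trans ?_ (Finset.mem_filter.1 hk).2
    refine Finset.sum_le_sum fun j _ => ?_
    rw [MvPolynomial.totalDegree_X_pow]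
  obtain ⟨σ, hσ⟩ := exists_sign hn hd hN1 P hP
  let a : Fin N → ℝ := fun i => sg (σ i) * H
  have ha : ∀ i, |a i| = H := by
    intro i
    simp only [a, abs_mul, sg_abs, one_mul, abs_of_pos hH0]
  have hbd := bumpSum_deriv_le m N a x r H hr0 hH0.le ha hxsep
  have hsup : ∀ y, |bumpSum m N a x r y| ≤ H := by
    intro y
    simpa using hbd 0 (by omega) y
  refine ⟨bumpSum m N a x r, ?_, ?_, ?_⟩
  · refine holder_of_bounds m α hα0 hα1 _ (contDiff_bumpSum m N a x r)
      (H * (2 * ((m:ℝ) + 2)) ^ (m + 1)) r (by positivity) hr0 hr1 ?_ ?_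
    · have h1 := Cinf1_bound m hm α hα1
      have h2 : r ^ ((m:ℝ) + α) = 1 / ((64:ℝ) ^ ((m:ℝ) + α) * E ^ l) := by
        rw [hr, Real.div_rpow (by norm_num) (by positivity), Real.one_rpow,
          Real.mul_rpow (by norm_num) hE0.le]
      rw [h2, le_div_iff₀ (by positivity)]
      refine le_trans (le_of_eq ?_) h1
      rw [hH]
      field_simp
    · intro k hk y
      refine (hbd k hk y).trans ?_
      have hm0 : (0:ℝ) ≤ m := Nat.cast_nonneg m
      gcongr
      linarith
  · intro y hy
    unfold bumpSum
    refine Finset.sum_eq_zero fun i _ => ?_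
    rw [bump_far, mul_zero]
    rw [abs_mul, abs_of_pos (inv_pos.2 hr0), inv_mul_eq_div, one_le_div hr0, abs_sub_comm]
    refine le_trans ?_ (le_abs_self _)
    have hi0 : (0:ℝ) ≤ ((i : ℕ) : ℝ) := Nat.cast_nonneg _
    have h1 : 0 ≤ ((i : ℕ) : ℝ) * r := by positivity
    have h2 := hy.2
    show r ≤ 1 / 20 + (2 * ((i : ℕ) : ℝ) + 1) * r - y
    linarith
  · intro ζ
    obtain ⟨i, hi⟩ := hσ ζ
    have hc1 := bumpSum_center m N a x r hr0 hxsep i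
    refine ⟨x i, hxI i, ?_, ?_, ?_, ?_⟩
    · rw [hc1, ha]
    · intro y _
      rw [hc1, ha]
      exact hsup y
    · rw [hc1, ha, mul_div_assoc]
      refine le_mul_of_one_le_left hH0.le ?_
      exact Real.one_le_rpow (by norm_num) (by positivity)
    · rw [hc1]
      have he : MvPolynomial.eval ζ (P i) = ∑ k ∈ degSet n d, c k (x i) * ∏ j, ζ j ^ k j := by
        simp [P]
      rw [← he]
      have : a i * MvPolynomial.eval ζ (P i) = H * (sg (σ i) * MvPolynomial.eval ζ (P i)) := by
        simp only [a]; ring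
      rw [this]
      exact mul_nonpos_of_nonneg_of_nonpos hH0.le hi

end
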